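/- arXiv:math/0610219 — 5 statements merged into one kernel-verified Lean document; each statement's English description precedes it below -/
import Mathlib

section
/- The unique zero Φ_k of H satisfies the bound |Φ_k| ≤ (sup_{x∈S} exp k(x)) · ∫_S |f(x)| ν(dx). -/
open MeasureTheory Real Set Filter

/-- A Bochner integral is bounded by that of any nonnegative integrable pointwise majorant,
without integrability of the integrand. -/
lemma setIntegral_le_of_le_of_nonneg {α : Type*} [MeasurableSpace α] {μ : Measure α} {s : Set α}
    (hs : MeasurableSet s) {g h : α → ℝ} (hh : IntegrableOn h s μ)
    (h_nonneg : ∀ x ∈ s, 0 ≤ h x) (hgh : ∀ x ∈ s, g x ≤ h x) :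
    ∫ x in s, g x ∂μ ≤ ∫ x in s, h x ∂μ := by
  by_cases hg : IntegrableOn g s μ
  · exact setIntegral_mono_on hg hh hs hgh
  · rw [integral_undef hg]
    exact setIntegral_nonneg hs h_nonneg

lemma mul_exp_sub_le {β z t κ M : ℝ} (hβ : 0 ≤ β) (hz : 0 ≤ z) (hM : Real.exp κ ≤ M) :
    t * Real.exp (κ - β * t * z) ≤ M * |t| := by
  have hM0 : 0 ≤ M := (Real.exp_pos κ).le.trans hM
  rcases le_total 0 t with ht | ht
  · have hexp : Real.exp (κ - β * t * z) ≤ M :=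
      (Real.exp_le_exp.2 (sub_le_self _ (by positivity))).trans hM
    rw [abs_of_nonneg ht, mul_comm M]
    exact mul_le_mul_of_nonneg_left hexp ht
  · exact (mul_nonpos_of_nonpos_of_nonneg ht (Real.exp_pos _).le).trans (by positivity)

/-- In the setting of Lemma 3.3 (`S ⊆ ℝ` measurable, `ν` σ-finite, `β > 0`,
`f` bounded and `ν`-integrable on `S`, `k` measurable and bounded from above on `S`), any zero
`Φ` of `H(z) = z − ∫_S f(x) exp(k(x) − β f(x) z) ν(dx)` satisfies
`|Φ| ≤ (sup_{x ∈ S} exp k(x)) · ∫_S |f(x)| ν(dx)`. -/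
theorem stmt_1
    (S : Set ℝ) (hS : MeasurableSet S)
    (ν : Measure ℝ) [SigmaFinite ν]
    (β : ℝ) (hβ : 0 < β)
    (f : ℝ → ℝ) (hf_meas : Measurable f)
    (Cf : ℝ) (hf_bdd : ∀ x ∈ S, |f x| ≤ Cf)
    (hf_int : IntegrableOn f S ν)
    (k : ℝ → ℝ) (hk_meas : Measurable k)
    (Ck : ℝ) (hk_bdd : ∀ x ∈ S, k x ≤ Ck)
    (Φ : ℝ)
    (hΦ : Φ - (∫ x in S, f x * Real.exp (k x - β * f x * Φ) ∂ν) = 0) :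
    |Φ| ≤ sSup ((fun x => Real.exp (k x)) '' S) * ∫ x in S, |f x| ∂ν := by
  set M := sSup ((fun x => Real.exp (k x)) '' S)
  have hM : ∀ x ∈ S, Real.exp (k x) ≤ M := fun x hx =>
    le_csSup ⟨Real.exp Ck, by
      rintro _ ⟨y, hy, rfl⟩
      exact Real.exp_le_exp.2 (hk_bdd y hy)⟩ ⟨x, hx, rfl⟩
  have h_int : IntegrableOn (fun x => M * |f x|) S ν := hf_int.abs.const_mul M
  have h_nonneg : ∀ x ∈ S, 0 ≤ M * |f x| := fun x hx =>
    mul_nonneg ((Real.exp_pos _).le.trans (hM x hx)) (abs_nonneg _)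
  have hΦ_eq := sub_eq_zero.1 hΦ
  rw [← integral_const_mul]
  rcases le_total 0 Φ with h | h
  · rw [abs_of_nonneg h]
    exact hΦ_eq.trans_le (setIntegral_le_of_le_of_nonneg hS h_int h_nonneg
      fun x hx => mul_exp_sub_le hβ.le h (hM x hx))
  · rw [abs_of_nonpos h]
    refine (congrArg Neg.neg hΦ_eq).trans_le ?_
    rw [← integral_neg]
    refine setIntegral_le_of_le_of_nonneg hS h_int h_nonneg fun x hx => ?_
    simpa using mul_exp_sub_le (t := -f x) hβ.le (neg_nonneg.2 h) (hM x hx)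
end

section
/- (Lemma 3.3) The function φ : S → ℝ defined by φ(x) = exp(k(x) − β f(x) Φ_k), where Φ_k is the unique zero of H, is the unique bounded measurable solution of the implicit equation φ(x) = exp{k(x) − β f(x) ∫_S f(z) φ(z) ν(dz)} for all x ∈ S; in particular such a bounded solution exists, it satisfies ∫_S f(z) φ(z) ν(dz) = Φ_k, and φ is bounded by exp(sup_x k(x) + β ‖f‖_∞ |Φ_k|). -/
open MeasureTheory Real Set Filter

theorem sub_mul_mul_le_add {κ β a z K A : ℝ} (hβ : 0 ≤ β) (hκ : κ ≤ K) (ha : |a| ≤ A) :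
    κ - β * a * z ≤ K + β * A * |z| := by
  have h : |β * a * z| ≤ β * A * |z| := by
    rw [abs_mul, abs_mul, abs_of_nonneg hβ]
    gcongr
  linarith [neg_abs_le (β * a * z)]

theorem integrableOn_mul_exp_sub {α : Type*} [MeasurableSpace α] {ν : Measure α} {S : Set α}
    (hS : MeasurableSet S) {β : ℝ} (hβ : 0 ≤ β) {f k : α → ℝ} (hf : Measurable f)
    (hk : Measurable k) {A K : ℝ} (hfA : ∀ x ∈ S, |f x| ≤ A) (hkK : ∀ x ∈ S, k x ≤ K)
    (hfi : IntegrableOn f S ν) (z : ℝ) :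
    IntegrableOn (fun x => f x * Real.exp (k x - β * f x * z)) S ν := by
  refine Integrable.mono' (hfi.norm.mul_const (Real.exp (K + β * A * |z|)))
    (by fun_prop) ((ae_restrict_iff' hS).2 (ae_of_all _ fun x hx => ?_))
  rw [norm_mul, Real.norm_of_nonneg (Real.exp_pos _).le]
  gcongr
  exact sub_mul_mul_le_add hβ (hkK x hx) (hfA x hx)

theorem mul_exp_sub_antitone {β : ℝ} (hβ : 0 ≤ β) (a κ : ℝ) :
    Antitone fun z : ℝ => a * Real.exp (κ - β * a * z) := by
  intro z w hzw
  dsimp only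
  rcases le_total 0 a with ha | ha
  · gcongr
  · refine mul_le_mul_of_nonpos_left (Real.exp_le_exp.2 (sub_le_sub_left ?_ κ)) ha
    exact mul_le_mul_of_nonpos_left hzw (mul_nonpos_of_nonneg_of_nonpos hβ ha)

theorem setIntegral_mul_exp_sub_antitone {α : Type*} [MeasurableSpace α] {ν : Measure α}
    {S : Set α} (hS : MeasurableSet S) {β : ℝ} (hβ : 0 ≤ β) {f k : α → ℝ} (hf : Measurable f)
    (hk : Measurable k) {A K : ℝ} (hfA : ∀ x ∈ S, |f x| ≤ A) (hkK : ∀ x ∈ S, k x ≤ K)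
    (hfi : IntegrableOn f S ν) :
    Antitone fun z : ℝ => ∫ x in S, f x * Real.exp (k x - β * f x * z) ∂ν := fun z w hzw =>
  integral_mono (integrableOn_mul_exp_sub hS hβ hf hk hfA hkK hfi w)
    (integrableOn_mul_exp_sub hS hβ hf hk hfA hkK hfi z)
    fun x => mul_exp_sub_antitone hβ (f x) (k x) hzw

theorem Antitone.fixedPoint_unique {α : Type*} [LinearOrder α] {g : α → α} (hg : Antitone g)
    {a b : α} (ha : g a = a) (hb : g b = b) : a = b := by
  rcases le_total a b with h | h
  · exact h.antisymm (by simpa only [ha, hb] using hg h)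
  · exact le_antisymm (by simpa only [ha, hb] using hg h) h

/-- **Lemma 3.3.** In the setting of Lemma 3.3, let `Φ` be the (unique) zero of
`H(z) = z − ∫_S f(x) exp(k(x) − β f(x) z) ν(dx)`.  Then `φ(x) = exp(k(x) − β f(x) Φ)` satisfies
`∫_S f φ dν = Φ`, it solves the implicit equation
`φ(x) = exp(k(x) − β f(x) ∫_S f(z) φ(z) ν(dz))` on `S`, it is the unique bounded measurable
solution of this equation (any two bounded measurable solutions agree on `S`), and it is bounded
by `exp(sup_{x∈S} k(x) + β ‖f‖_∞ |Φ|)`. -/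
theorem stmt_2
    (S : Set ℝ) (hS : MeasurableSet S)
    (ν : Measure ℝ) [SigmaFinite ν]
    (β : ℝ) (hβ : 0 < β)
    (f : ℝ → ℝ) (hf_meas : Measurable f)
    (Cf : ℝ) (hf_bdd : ∀ x ∈ S, |f x| ≤ Cf)
    (hf_int : IntegrableOn f S ν)
    (k : ℝ → ℝ) (hk_meas : Measurable k)
    (Ck : ℝ) (hk_bdd : ∀ x ∈ S, k x ≤ Ck)
    (Φ : ℝ)
    (hΦ : Φ - (∫ x in S, f x * Real.exp (k x - β * f x * Φ) ∂ν) = 0) :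
    let φ : ℝ → ℝ := fun x => Real.exp (k x - β * f x * Φ)
    (∫ x in S, f x * φ x ∂ν) = Φ ∧
    (∀ x ∈ S, φ x = Real.exp (k x - β * f x * ∫ z in S, f z * φ z ∂ν)) ∧
    (∀ ψ : ℝ → ℝ, Measurable ψ → (∃ C : ℝ, ∀ x ∈ S, |ψ x| ≤ C) →
      (∀ x ∈ S, ψ x = Real.exp (k x - β * f x * ∫ z in S, f z * ψ z ∂ν)) →
      Set.EqOn ψ φ S) ∧
    (∀ C : ℝ, (∀ x ∈ S, |f x| ≤ C) →
      ∀ x ∈ S, φ x ≤ Real.exp (sSup (k '' S) + β * C * |Φ|)) := by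
  intro φ
  have hfix : (∫ x in S, f x * φ x ∂ν) = Φ := (sub_eq_zero.1 hΦ).symm
  refine ⟨hfix, fun x _ => by rw [hfix], fun ψ _ _ hψ => ?_, fun C hC x hx => ?_⟩
  · have hψfix : (∫ x in S, f x * Real.exp (k x - β * f x * ∫ z in S, f z * ψ z ∂ν) ∂ν) =
        ∫ z in S, f z * ψ z ∂ν :=
      setIntegral_congr_fun hS fun x hx => congrArg (f x * ·) (hψ x hx).symm
    have hint : (∫ z in S, f z * ψ z ∂ν) = Φ :=
      (setIntegral_mul_exp_sub_antitone hS hβ.le hf_meas hk_meas hf_bdd hk_bdd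
        hf_int).fixedPoint_unique hψfix hfix
    intro x hx
    rw [hψ x hx, hint]
  · have hbdd : BddAbove (k '' S) := ⟨Ck, forall_mem_image.2 hk_bdd⟩
    exact Real.exp_le_exp.2
      (sub_mul_mul_le_add hβ.le (le_csSup hbdd (mem_image_of_mem k hx)) (hC x hx))
end

section
/- Let c > 0 and define, for r ∈ [0,1], the perturbed function k⁺(r)(x) = k(x) + r c (1_{f(x)>0} − 1_{f(x)<0}). Then r ↦ Φ_{k⁺(r)} is nondecreasing on [0,1] and, with K* := sup_{s∈[0,1]} sup_{x∈S} φ_{k⁺(s)}(x) (which is finite), one has for every r ∈ [0,1]: 0 ≤ Φ_{k⁺(r)} − Φ_{k⁺(0)} ≤ c r K* ∫_S |f(x)| ν(dx). -/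
open MeasureTheory Real Set Filter

/-- The indicator difference `1_{0 < y} − 1_{y < 0}`. -/
noncomputable def indicatorSign (y : ℝ) : ℝ :=
  (if 0 < y then (1 : ℝ) else 0) - if y < 0 then 1 else 0

lemma indicatorSign_of_pos {y : ℝ} (hy : 0 < y) : indicatorSign y = 1 := by
  simp [indicatorSign, hy, hy.le]

lemma indicatorSign_of_neg {y : ℝ} (hy : y < 0) : indicatorSign y = -1 := by
  simp [indicatorSign, hy, hy.le]

lemma indicatorSign_le_one (y : ℝ) : indicatorSign y ≤ 1 := by
  unfold indicatorSign
  split_ifs <;> norm_num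

lemma measurable_indicatorSign : Measurable indicatorSign :=
  (Measurable.ite measurableSet_Ioi measurable_const measurable_const).sub
    (Measurable.ite measurableSet_Iio measurable_const measurable_const)

lemma exp_sub_exp_le (a b : ℝ) : exp a - exp b ≤ exp a * (a - b) := by
  have h := add_one_le_exp (b - a)
  have h2 : exp b = exp a * exp (b - a) := by rw [← exp_add]; ring_nf
  nlinarith [exp_pos a]

lemma mul_exp_tilt_mono {y κ u v β z w : ℝ} (hβ : 0 < β) (huv : u ≤ v) (hzw : w ≤ z) :
    y * exp (κ + u * indicatorSign y - β * y * z) ≤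
      y * exp (κ + v * indicatorSign y - β * y * w) := by
  rcases lt_trichotomy y 0 with hy | rfl | hy
  · rw [indicatorSign_of_neg hy]
    refine mul_le_mul_of_nonpos_left (exp_le_exp.2 ?_) hy.le
    nlinarith [mul_nonneg_of_nonpos_of_nonpos (mul_neg_of_pos_of_neg hβ hy).le
      (sub_nonpos.2 hzw)]
  · simp
  · rw [indicatorSign_of_pos hy]
    refine mul_le_mul_of_nonneg_left (exp_le_exp.2 ?_) hy.le
    nlinarith [mul_nonneg (mul_pos hβ hy).le (sub_nonneg.2 hzw)]

lemma mul_exp_tilt_sub_le {y κ u v β z w K : ℝ} (hβ : 0 < β) (huv : u ≤ v) (hzw : z ≤ w)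
    (hu : exp (κ + u * indicatorSign y - β * y * z) ≤ K)
    (hv : exp (κ + v * indicatorSign y - β * y * w) ≤ K) :
    y * exp (κ + v * indicatorSign y - β * y * w) -
      y * exp (κ + u * indicatorSign y - β * y * z) ≤ (v - u) * K * |y| := by
  set a := κ + v * indicatorSign y - β * y * w with ha
  set b := κ + u * indicatorSign y - β * y * z with hb
  have hd : 0 ≤ v - u := sub_nonneg.2 huv
  rcases lt_trichotomy y 0 with hy | rfl | hy
  · rw [indicatorSign_of_neg hy] at ha hb
    have h1 : b - a ≤ v - u := by
      nlinarith [mul_nonneg (mul_pos hβ (neg_pos.2 hy)).le (sub_nonneg.2 hzw)]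
    have h2 : exp b - exp a ≤ (v - u) * K := by
      nlinarith [exp_sub_exp_le b a, mul_le_mul_of_nonneg_left h1 (exp_pos b).le,
        mul_le_mul_of_nonneg_left hu hd]
    rw [abs_of_neg hy]
    nlinarith [mul_le_mul_of_nonneg_left h2 (neg_pos.2 hy).le]
  · simp
  · rw [indicatorSign_of_pos hy] at ha hb
    have h1 : a - b ≤ v - u := by
      nlinarith [mul_nonneg (mul_pos hβ hy).le (sub_nonneg.2 hzw)]
    have h2 : exp a - exp b ≤ (v - u) * K := by
      nlinarith [exp_sub_exp_le a b, mul_le_mul_of_nonneg_left h1 (exp_pos a).le,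
        mul_le_mul_of_nonneg_left hv hd]
    rw [abs_of_pos hy]
    nlinarith [mul_le_mul_of_nonneg_left h2 hy.le]

lemma exp_tilt_le {y κ u β z C D M : ℝ} (hβ : 0 < β) (hy : |y| ≤ C) (hκ : κ ≤ D)
    (hu : 0 ≤ u) (hz : |z| ≤ M) :
    exp (κ + u * indicatorSign y - β * y * z) ≤ exp (D + u + β * (C * M)) := by
  have h1 : |y * z| ≤ C * M := by
    rw [abs_mul]
    exact mul_le_mul hy hz (abs_nonneg z) ((abs_nonneg y).trans hy)
  have h2 : β * -(y * z) ≤ β * (C * M) :=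
    mul_le_mul_of_nonneg_left ((neg_le_abs _).trans h1) hβ.le
  have h3 := mul_le_mul_of_nonneg_left (indicatorSign_le_one y) hu
  exact exp_le_exp.2 (by linarith)

lemma integrableOn_mul_exp_tilt {S : Set ℝ} (hS : MeasurableSet S) {ν : Measure ℝ}
    {β : ℝ} (hβ : 0 < β) {f : ℝ → ℝ} (hf_meas : Measurable f) {Cf : ℝ}
    (hf_bdd : ∀ x ∈ S, |f x| ≤ Cf) (hf_int : IntegrableOn f S ν)
    {k : ℝ → ℝ} (hk_meas : Measurable k) {Ck : ℝ} (hk_bdd : ∀ x ∈ S, k x ≤ Ck)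
    {u : ℝ} (hu : 0 ≤ u) (z : ℝ) :
    IntegrableOn (fun x => f x * exp (k x + u * indicatorSign (f x) - β * f x * z)) S ν := by
  refine Integrable.mul_bdd (c := exp (Ck + u + β * (Cf * |z|))) hf_int ?_ ?_
  · have := measurable_indicatorSign.comp hf_meas
    exact (measurable_exp.comp ((hk_meas.add (this.const_mul u)).sub
      ((hf_meas.const_mul β).mul_const z))).aestronglyMeasurable
  · filter_upwards [ae_restrict_mem hS] with x hx
    rw [norm_of_nonneg (exp_pos _).le]
    exact exp_tilt_le hβ (hf_bdd x hx) (hk_bdd x hx) hu le_rfl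

/-- In the setting of Lemma 3.3, let `c > 0` and, for `r ∈ [0,1]`, let
`k⁺(r)(x) = k(x) + r c (1_{f(x)>0} − 1_{f(x)<0})` and let `Φ r` be the corresponding
fixed-point value, i.e. `Φ r = ∫_S f(x) exp(k⁺(r)(x) − β f(x) Φ r) ν(dx)`.  Then `r ↦ Φ r` is
nondecreasing on `[0,1]`, the family `φ_{k⁺(s)}(x) = exp(k⁺(s)(x) − β f(x) Φ s)`,
`s ∈ [0,1]`, `x ∈ S`, is bounded above, and with `K* := sup_{s,x} φ_{k⁺(s)}(x)` one has
`0 ≤ Φ r − Φ 0 ≤ c r K* ∫_S |f| dν` for every `r ∈ [0,1]`. -/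
theorem stmt_4
    (S : Set ℝ) (hS : MeasurableSet S)
    (ν : Measure ℝ) [SigmaFinite ν]
    (β : ℝ) (hβ : 0 < β)
    (f : ℝ → ℝ) (hf_meas : Measurable f)
    (Cf : ℝ) (hf_bdd : ∀ x ∈ S, |f x| ≤ Cf)
    (hf_int : IntegrableOn f S ν)
    (k : ℝ → ℝ) (hk_meas : Measurable k)
    (Ck : ℝ) (hk_bdd : ∀ x ∈ S, k x ≤ Ck)
    (c : ℝ) (hc : 0 < c)
    (Φ : ℝ → ℝ)
    (hΦ : ∀ r ∈ Set.Icc (0:ℝ) 1,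
      Φ r = ∫ x in S, f x *
        Real.exp ((k x + r * c * ((if 0 < f x then (1:ℝ) else 0) - if f x < 0 then 1 else 0))
          - β * f x * Φ r) ∂ν) :
    let A : Set ℝ := {w : ℝ | ∃ s ∈ Set.Icc (0:ℝ) 1, ∃ x ∈ S,
      w = Real.exp ((k x + s * c * ((if 0 < f x then (1:ℝ) else 0) - if f x < 0 then 1 else 0))
        - β * f x * Φ s)}
    MonotoneOn Φ (Set.Icc 0 1) ∧
    BddAbove A ∧
    (∀ r ∈ Set.Icc (0:ℝ) 1,
      0 ≤ Φ r - Φ 0 ∧ Φ r - Φ 0 ≤ c * r * sSup A * ∫ x in S, |f x| ∂ν) := by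
  intro A
  have hint : ∀ r ∈ Set.Icc (0 : ℝ) 1, IntegrableOn
      (fun x => f x * exp (k x + r * c * indicatorSign (f x) - β * f x * Φ r)) S ν :=
    fun r hr => integrableOn_mul_exp_tilt hS hβ hf_meas hf_bdd hf_int hk_meas hk_bdd
      (mul_nonneg hr.1 hc.le) _
  have hmono : MonotoneOn Φ (Set.Icc 0 1) := by
    intro r hr s hs hrs
    by_contra! hlt
    refine hlt.not_ge ?_
    rw [hΦ r hr, hΦ s hs]
    exact setIntegral_mono (hint r hr) (hint s hs) fun x =>
      mul_exp_tilt_mono hβ (mul_le_mul_of_nonneg_right hrs hc.le) hlt.le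
  have h0 : (0 : ℝ) ∈ Set.Icc (0 : ℝ) 1 := by simp
  have h1 : (1 : ℝ) ∈ Set.Icc (0 : ℝ) 1 := by simp
  have hA : BddAbove A := by
    refine ⟨exp (Ck + c + β * (Cf * max |Φ 0| |Φ 1|)), ?_⟩
    rintro _ ⟨s, hs, x, hx, rfl⟩
    refine (exp_tilt_le hβ (hf_bdd x hx) (hk_bdd x hx) (mul_nonneg hs.1 hc.le)
      (abs_le_max_abs_abs (hmono h0 hs hs.1) (hmono hs h1 hs.2))).trans ?_
    gcongr
    exact mul_le_of_le_one_left hc.le hs.2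
  refine ⟨hmono, hA, fun r hr => ?_⟩
  have hr0 : Φ 0 ≤ Φ r := hmono h0 hr hr.1
  refine ⟨sub_nonneg.2 hr0, ?_⟩
  calc Φ r - Φ 0
      = ∫ x in S, (f x * exp (k x + r * c * indicatorSign (f x) - β * f x * Φ r) -
          f x * exp (k x + 0 * c * indicatorSign (f x) - β * f x * Φ 0)) ∂ν := by
        rw [integral_sub (hint r hr) (hint 0 h0)]
        exact congrArg₂ _ (hΦ r hr) (hΦ 0 h0)
    _ ≤ ∫ x in S, c * r * sSup A * |f x| ∂ν := by
        refine setIntegral_mono_on ((hint r hr).sub (hint 0 h0)) (hf_int.abs.const_mul _) hS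
          fun x hx => ?_
        refine (mul_exp_tilt_sub_le (K := sSup A) hβ
          (mul_le_mul_of_nonneg_right hr.1 hc.le) hr0
          (le_csSup hA ⟨0, h0, x, hx, rfl⟩) (le_csSup hA ⟨r, hr, x, hx, rfl⟩)).trans_eq ?_
        ring
    _ = c * r * sSup A * ∫ x in S, |f x| ∂ν := integral_const_mul _ _
end

section
/- (Lemma 3.5) For each fixed y ∈ E, the map v ↦ W^L(v)(y, ·) from C_b^Q(E) into L¹(ν) is Lipschitz-continuous: there is a constant L_Q < ∞, depending only on Q, σ, λ̂, ‖W^M‖_∞, ∫_S |W^M| dν and ν(S), and in particular independent of y, such that ‖W^L(v₁)(y,·) − W^L(v₂)(y,·)‖_{L¹(ν)} ≤ L_Q ‖v₁ − v₂‖_∞ for all v₁, v₂ ∈ C_b^Q(E). -/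
open MeasureTheory Real Set Filter

lemma exists_exp_sub_eq_mul_sub {a b B : ℝ} (ha : a ≤ B) (hb : b ≤ B) :
    ∃ k, 0 ≤ k ∧ k ≤ exp B ∧ exp a - exp b = k * (a - b) := by
  wlog hab : b ≤ a generalizing a b
  · obtain ⟨k, hk, hkB, h⟩ := this hb ha (le_of_not_ge hab)
    exact ⟨k, hk, hkB, by linarith⟩
  rcases hab.eq_or_lt with rfl | hab
  · exact ⟨0, le_rfl, (exp_pos B).le, by simp⟩
  have hpos : 0 < a - b := sub_pos.2 hab
  refine ⟨(exp a - exp b) / (a - b), ?_, ?_, ?_⟩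
  · exact div_nonneg (sub_nonneg.2 (exp_le_exp.2 hab.le)) hpos.le
  · rw [div_le_iff₀ hpos]
    have h1 : exp b = exp a * exp (b - a) := by rw [← exp_add]; ring_nf
    have h2 := add_one_le_exp (b - a)
    have h3 : exp a * (b - a + 1) ≤ exp a * exp (b - a) :=
      mul_le_mul_of_nonneg_left h2 (exp_pos a).le
    have h4 : exp a * (a - b) ≤ exp B * (a - b) :=
      mul_le_mul_of_nonneg_right (exp_le_exp.2 ha) hpos.le
    linarith
  · field_simp

lemma mul_exp_sub_le_abs_mul_exp (D t : ℝ) : t * exp (D - t) ≤ |t| * exp D := by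
  rcases le_total 0 t with ht | ht
  · rw [abs_of_nonneg ht]
    exact mul_le_mul_of_nonneg_left (exp_le_exp.2 (by linarith)) ht
  · exact (mul_nonpos_of_nonpos_of_nonneg ht (exp_pos _).le).trans (by positivity)

lemma abs_le_of_mul_self_le_abs_mul {t B : ℝ} (hB : 0 ≤ B) (h : t * t ≤ |t| * B) : |t| ≤ B := by
  rcases (abs_nonneg t).eq_or_lt with ht | ht
  · rwa [← ht]
  · rw [← abs_mul_abs_self] at h
    exact le_of_mul_le_mul_left h ht

/-- A priori bound for the tilting parameter `θ` of the exponential fixed point equation. -/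
lemma abs_tilt_le {α : Type*} [MeasurableSpace α] {μ : Measure α} {w f D : α → ℝ}
    {c lam R N θ : ℝ} (hc : 0 ≤ c) (hN : 0 ≤ N) (hw : Integrable w μ)
    (hwf : Integrable (fun x ↦ w x * f x) μ) (hθ : θ = lam + c * ∫ x, w x * f x ∂μ)
    (hwN : ∀ᵐ x ∂μ, |w x| ≤ N) (hD : ∀ᵐ x ∂μ, D x ≤ R)
    (heq : ∀ᵐ x ∂μ, exp (D x - θ * w x) = 1 - lam * w x + f x) :
    |θ| ≤ |lam| + c * ((exp R + 1 + |lam| * N) * ∫ x, |w x| ∂μ) := by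
  have hpt : ∀ᵐ x ∂μ,
      θ * (w x * f x) ≤ |θ| * ((exp R + 1 + |lam| * N) * |w x|) := by
    filter_upwards [hwN, hD, heq] with x h1 h2 h3
    have h4 := mul_exp_sub_le_abs_mul_exp (D x) (θ * w x)
    have h5 : |θ * w x| * exp (D x) ≤ |θ * w x| * exp R :=
      mul_le_mul_of_nonneg_left (exp_le_exp.2 h2) (abs_nonneg _)
    have h6 : θ * w x * (lam * w x - 1) ≤ |θ * w x| * (|lam| * N + 1) := by
      refine (le_abs_self _).trans ?_
      rw [abs_mul (θ * w x)]
      refine mul_le_mul_of_nonneg_left ?_ (abs_nonneg _)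
      refine (abs_sub _ _).trans ?_
      rw [abs_mul, abs_one]
      gcongr
    have h7 : θ * (w x * f x)
        = θ * w x * exp (D x - θ * w x) + θ * w x * (lam * w x - 1) := by
      rw [h3]; ring
    have h8 : |θ| * ((exp R + 1 + |lam| * N) * |w x|)
        = |θ * w x| * exp R + |θ * w x| * (|lam| * N + 1) := by
      rw [abs_mul]; ring
    linarith
  have hint := integral_mono_ae (hwf.const_mul θ) ((hw.abs.const_mul _).const_mul _) hpt
  simp only [integral_const_mul] at hint
  have hI : 0 ≤ ∫ x, |w x| ∂μ := integral_nonneg fun x ↦ abs_nonneg _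
  refine abs_le_of_mul_self_le_abs_mul (by positivity) ?_
  have h1 := mul_le_mul_of_nonneg_left hint hc
  have h2 : θ * lam ≤ |θ| * |lam| := by
    rw [← abs_mul]; exact le_abs_self _
  calc θ * θ = θ * lam + c * (θ * ∫ x, w x * f x ∂μ) := by
        conv_lhs => enter [2]; rw [hθ]
        ring
    _ ≤ _ := by linarith

/-- Stability of the tilting parameter of the exponential fixed point equation. -/
lemma abs_tilt_sub_le {α : Type*} [MeasurableSpace α] {μ : Measure α} {w f g D D' : α → ℝ}
    {c lam B δ θ η : ℝ} (hc : 0 ≤ c) (hδ : 0 ≤ δ) (hw : Integrable w μ)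
    (hwf : Integrable (fun x ↦ w x * f x) μ) (hwg : Integrable (fun x ↦ w x * g x) μ)
    (hθ : θ = lam + c * ∫ x, w x * f x ∂μ) (hη : η = lam + c * ∫ x, w x * g x ∂μ)
    (hB : ∀ᵐ x ∂μ, D x - θ * w x ≤ B) (hB' : ∀ᵐ x ∂μ, D' x - η * w x ≤ B)
    (hD : ∀ᵐ x ∂μ, |D x - D' x| ≤ δ)
    (hf : ∀ᵐ x ∂μ, exp (D x - θ * w x) = 1 - lam * w x + f x)
    (hg : ∀ᵐ x ∂μ, exp (D' x - η * w x) = 1 - lam * w x + g x) :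
    |θ - η| ≤ c * (exp B * δ * ∫ x, |w x| ∂μ) := by
  have hpt : ∀ᵐ x ∂μ,
      (θ - η) * (w x * f x - w x * g x) ≤ |θ - η| * (exp B * δ * |w x|) := by
    filter_upwards [hB, hB', hD, hf, hg] with x h1 h2 h3 h4 h5
    obtain ⟨k, hk, hkB, h⟩ := exists_exp_sub_eq_mul_sub h1 h2
    have h6 : (θ - η) * w x * (D x - D' x) ≤ |(θ - η) * w x| * δ := by
      refine (le_abs_self _).trans ?_
      rw [abs_mul ((θ - η) * w x)]
      gcongr
    calc (θ - η) * (w x * f x - w x * g x)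
        = (θ - η) * w x * (exp (D x - θ * w x) - exp (D' x - η * w x)) := by
          rw [h4, h5]; ring
      _ = k * ((θ - η) * w x * (D x - D' x)) - k * ((θ - η) * w x) ^ 2 := by
          rw [h]; ring
      _ ≤ k * ((θ - η) * w x * (D x - D' x)) := sub_le_self _ (by positivity)
      _ ≤ k * (|(θ - η) * w x| * δ) := mul_le_mul_of_nonneg_left h6 hk
      _ ≤ exp B * (|(θ - η) * w x| * δ) := by gcongr
      _ = |θ - η| * (exp B * δ * |w x|) := by rw [abs_mul]; ring
  have hint := integral_mono_ae ((hwf.sub hwg).const_mul (θ - η))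
    ((hw.abs.const_mul _).const_mul _) hpt
  simp only [integral_const_mul, Pi.sub_apply] at hint
  rw [integral_sub hwf hwg] at hint
  have hI : 0 ≤ ∫ x, |w x| ∂μ := integral_nonneg fun x ↦ abs_nonneg _
  refine abs_le_of_mul_self_le_abs_mul (by positivity) ?_
  have h1 := mul_le_mul_of_nonneg_left hint hc
  have h2 : θ - η = c * (∫ x, w x * f x ∂μ - ∫ x, w x * g x ∂μ) := by
    rw [hθ, hη]; ring
  calc (θ - η) * (θ - η)
      = c * ((θ - η) * (∫ x, w x * f x ∂μ - ∫ x, w x * g x ∂μ)) := by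
        conv_lhs => enter [2]; rw [h2]
        ring
    _ ≤ _ := by linarith

/-- `L¹`-stability of the solution of the exponential fixed point equation. -/
lemma integral_abs_sub_le_of_tilt {α : Type*} [MeasurableSpace α] {μ : Measure α}
    [IsFiniteMeasure μ] {w f g D D' : α → ℝ}
    {lam B δ θ η : ℝ} (hw : Integrable w μ) (hfi : Integrable f μ) (hgi : Integrable g μ)
    (hB : ∀ᵐ x ∂μ, D x - θ * w x ≤ B) (hB' : ∀ᵐ x ∂μ, D' x - η * w x ≤ B)
    (hD : ∀ᵐ x ∂μ, |D x - D' x| ≤ δ)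
    (hf : ∀ᵐ x ∂μ, exp (D x - θ * w x) = 1 - lam * w x + f x)
    (hg : ∀ᵐ x ∂μ, exp (D' x - η * w x) = 1 - lam * w x + g x) :
    ∫ x, |f x - g x| ∂μ ≤ exp B * (μ.real univ * δ + |θ - η| * ∫ x, |w x| ∂μ) := by
  have hpt : ∀ᵐ x ∂μ, |f x - g x| ≤ exp B * (δ + |θ - η| * |w x|) := by
    filter_upwards [hB, hB', hD, hf, hg] with x h1 h2 h3 h4 h5
    obtain ⟨k, hk, hkB, h⟩ := exists_exp_sub_eq_mul_sub h1 h2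
    have h6 : f x - g x = k * ((D x - D' x) - (θ - η) * w x) := by
      linear_combination h - h4 + h5
    rw [h6, abs_mul, abs_of_nonneg hk]
    refine mul_le_mul hkB ((abs_sub _ _).trans ?_) (abs_nonneg _) (exp_pos B).le
    rw [abs_mul]
    gcongr
  have hint := integral_mono_ae (hfi.sub hgi).abs
    (((integrable_const δ).add (hw.abs.const_mul |θ - η|)).const_mul (exp B)) hpt
  refine hint.trans_eq ?_
  simp only [Pi.add_apply]
  rw [integral_const_mul, integral_add (integrable_const δ) (hw.abs.const_mul _),
    integral_const_mul, integral_const, smul_eq_mul]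

/-- **Lemma 3.5.** Let `S ⊆ ℝ` be measurable, `ν` a finite measure, `σ > 0`,
`λ̂ ∈ ℝ`, `Q > 0` and `W^M : S → (−1,∞)` bounded (by `CM`) and `ν`-integrable.  There is a
constant `L` (depending only on `Q, σ, λ̂, ‖W^M‖_∞, ∫_S |W^M| dν` and `ν(S)`, and in particular
independent of the interval `E`, of `W^V` and of the point `y ∈ E`) such that whenever
`W^L(v)(y,·)` denotes the unique bounded solution of
`exp{Δv(y,x) − [λ̂ + σ⁻² ∫_S W^M W^L(v)(y,·) dν] W^M(x)} = 1 − λ̂ W^M(x) + W^L(v)(y,x)`,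
with `Δv(y,x) = v(y + W^V(y,x)) − v(y)`, the map `v ↦ W^L(v)(y,·)` is Lipschitz from
`C_b^Q(E)` into `L¹(ν)`:
`‖W^L(v₁)(y,·) − W^L(v₂)(y,·)‖_{L¹(ν)} ≤ L · ‖v₁ − v₂‖_∞`. -/
theorem stmt_6
    (S : Set ℝ) (hS : MeasurableSet S)
    (ν : Measure ℝ) [IsFiniteMeasure ν]
    (σ lam Q : ℝ) (hσ : 0 < σ) (hQ : 0 < Q)
    (WM : ℝ → ℝ) (hWM_meas : Measurable WM)
    (hWM_gt : ∀ x ∈ S, -1 < WM x)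
    (CM : ℝ) (hWM_bdd : ∀ x ∈ S, |WM x| ≤ CM)
    (hWM_int : IntegrableOn WM S ν) :
    ∃ L : ℝ, ∀ E : Set ℝ, E.OrdConnected → E.Nonempty →
      ∀ WV : ℝ → ℝ → ℝ, (∀ y ∈ E, ∀ x ∈ S, y + WV y x ∈ E) →
      ∀ WL : (ℝ → ℝ) → ℝ → ℝ → ℝ,
      (∀ v : ℝ → ℝ, ContinuousOn v E → (∀ z ∈ E, |v z| ≤ Q) → ∀ y ∈ E,
        Measurable (WL v y) ∧ (∃ C : ℝ, ∀ x ∈ S, |WL v y x| ≤ C) ∧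
        IntegrableOn (WL v y) S ν ∧
        ∀ x ∈ S,
          Real.exp ((v (y + WV y x) - v y)
              - (lam + (σ ^ 2)⁻¹ * ∫ z in S, WM z * WL v y z ∂ν) * WM x)
            = 1 - lam * WM x + WL v y x) →
      ∀ y ∈ E, ∀ v₁ v₂ : ℝ → ℝ,
        ContinuousOn v₁ E → (∀ z ∈ E, |v₁ z| ≤ Q) →
        ContinuousOn v₂ E → (∀ z ∈ E, |v₂ z| ≤ Q) →
        ∀ M : ℝ, (∀ z ∈ E, |v₁ z - v₂ z| ≤ M) →
        (∫ x in S, |WL v₁ y x - WL v₂ y x| ∂ν) ≤ L * M := by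
  set A := ∫ x in S, |WM x| ∂ν with hA
  set c := (σ ^ 2)⁻¹ with hc_def
  have hc : 0 ≤ c := by positivity
  set T := |lam| + c * ((exp (2 * Q) + 1 + |lam| * |CM|) * A) with hT
  have hA0 : 0 ≤ A := integral_nonneg fun x ↦ abs_nonneg _
  have hT0 : 0 ≤ T := by positivity
  set B := 2 * Q + T * |CM| with hB
  refine ⟨exp B * ((ν.restrict S).real univ * 2 + c * (exp B * 2 * A) * A), ?_⟩
  intro E _ _ WV hWV WL hWL y hy v₁ v₂ hv₁ hQ₁ hv₂ hQ₂ M hM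
  have hM0 : 0 ≤ M := (abs_nonneg _).trans (hM y hy)
  have hwN : ∀ᵐ x ∂ν.restrict S, |WM x| ≤ |CM| :=
    ae_restrict_of_forall_mem hS fun x hx ↦ (hWM_bdd x hx).trans (le_abs_self _)
  have key : ∀ v : ℝ → ℝ, ContinuousOn v E → (∀ z ∈ E, |v z| ≤ Q) →
      Integrable (fun x ↦ WM x * WL v y x) (ν.restrict S) ∧
      ∀ᵐ x ∂ν.restrict S, (v (y + WV y x) - v y)
        - (lam + c * ∫ z in S, WM z * WL v y z ∂ν) * WM x ≤ B := by
    intro v hv hvQ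
    obtain ⟨hm, ⟨C, hC⟩, -, heq⟩ := hWL v hv hvQ y hy
    have hi : Integrable (fun x ↦ WM x * WL v y x) (ν.restrict S) :=
      hWM_int.mul_bdd (c := C) hm.aestronglyMeasurable (ae_restrict_of_forall_mem hS hC)
    have hD : ∀ᵐ x ∂ν.restrict S, v (y + WV y x) - v y ≤ 2 * Q :=
      ae_restrict_of_forall_mem hS fun x hx ↦ by
        have h1 := abs_le.1 (hvQ _ (hWV y hy x hx))
        have h2 := abs_le.1 (hvQ y hy)
        linarith
    refine ⟨hi, ?_⟩
    have hθ := abs_tilt_le hc (abs_nonneg CM) hWM_int hi rfl hwN hD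
      (ae_restrict_of_forall_mem hS heq)
    filter_upwards [hD, hwN] with x h1 h2
    have h3 : |(lam + c * ∫ z in S, WM z * WL v y z ∂ν) * WM x| ≤ T * |CM| := by
      rw [abs_mul]
      exact mul_le_mul hθ h2 (abs_nonneg _) hT0
    have h4 := neg_abs_le ((lam + c * ∫ z in S, WM z * WL v y z ∂ν) * WM x)
    linarith
  obtain ⟨hi₁, hB₁⟩ := key v₁ hv₁ hQ₁
  obtain ⟨hi₂, hB₂⟩ := key v₂ hv₂ hQ₂
  obtain ⟨-, -, hf, heq₁⟩ := hWL v₁ hv₁ hQ₁ y hy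
  obtain ⟨-, -, hg, heq₂⟩ := hWL v₂ hv₂ hQ₂ y hy
  have hD : ∀ᵐ x ∂ν.restrict S,
      |(v₁ (y + WV y x) - v₁ y) - (v₂ (y + WV y x) - v₂ y)| ≤ 2 * M :=
    ae_restrict_of_forall_mem hS fun x hx ↦ by
      have h1 := abs_le.1 (hM _ (hWV y hy x hx))
      have h2 := abs_le.1 (hM y hy)
      exact abs_le.2 ⟨by linarith, by linarith⟩
  have heq₁ := ae_restrict_of_forall_mem (μ := ν) hS heq₁
  have heq₂ := ae_restrict_of_forall_mem (μ := ν) hS heq₂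
  have hθ := abs_tilt_sub_le hc (by positivity) hWM_int hi₁ hi₂ rfl rfl hB₁ hB₂ hD heq₁ heq₂
  refine (integral_abs_sub_le_of_tilt hWM_int hf hg hB₁ hB₂ hD heq₁ heq₂).trans ?_
  calc _ ≤ exp B * ((ν.restrict S).real univ * (2 * M)
        + c * (exp B * (2 * M) * A) * A) := by gcongr
    _ = _ := by ring
end

section
/- (Self-map estimate in the proof of Theorem 3.7) Suppose the derivative of the flow is uniformly bounded, |∂_z Z_s^{t,z}| ≤ L_Z for all t ≤ s ≤ T and z ∈ E, and set L_h := ‖h'‖_∞. Then for every β > 0, every v ∈ C_b([0,T]×E) and every (t,z) ∈ [0,T]×E, e^{−β(T−t)} |(Ĝ v)(t,z)| ≤ (L_Z L / β) ‖v‖_β + L_Z K T + L_Z L_h, where ‖v‖_β := sup_{(t,z)} e^{−β(T−t)} |v(t,z)|. In particular, for β = 2 L_Z L, the operator Ĝ maps the set N := { v ∈ C_b([0,T]×E) : ‖v‖_β ≤ 2 L_Z (K T + L_h) } into itself. -/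
open MeasureTheory Real Set Filter

/-- Exponentially weighted bound: if `|f|` is dominated on `(t, T]` by `A e^{β(T-s)} + B`, then the
integral of `f`, discounted by `e^{-β(T-t)}`, is at most `A / β + B (T - t)`. -/
theorem exp_mul_abs_integral_le {A B β t T : ℝ} (hA : 0 ≤ A) (hB : 0 ≤ B) (hβ : 0 < β)
    (ht : t ≤ T) {f : ℝ → ℝ}
    (hf : ∀ s ∈ Set.Ioc t T, |f s| ≤ A * Real.exp (β * (T - s)) + B) :
    Real.exp (-β * (T - t)) * |∫ s in t..T, f s| ≤ A / β + B * (T - t) := by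
  have hderiv : ∀ s : ℝ, HasDerivAt (fun s => -(A / β) * Real.exp (β * (T - s)) + B * s)
      (A * Real.exp (β * (T - s)) + B) s := by
    intro s
    have h₁ : HasDerivAt (fun s => β * (T - s)) (β * (-1)) s :=
      ((hasDerivAt_id s).const_sub T).const_mul β
    refine ((h₁.exp.const_mul (-(A / β))).add ((hasDerivAt_id s).const_mul B)).congr_deriv ?_
    field_simp
  have hcont : Continuous fun s => A * Real.exp (β * (T - s)) + B := by fun_prop
  have hint : ∫ s in t..T, (A * Real.exp (β * (T - s)) + B) =
      A / β * (Real.exp (β * (T - t)) - 1) + B * (T - t) := by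
    rw [intervalIntegral.integral_eq_sub_of_hasDerivAt (fun s _ => hderiv s)
      (hcont.intervalIntegrable _ _)]
    simp only [sub_self, mul_zero, Real.exp_zero]
    ring
  have hle : |∫ s in t..T, f s| ≤ A / β * (Real.exp (β * (T - t)) - 1) + B * (T - t) := by
    rw [← hint, ← Real.norm_eq_abs]
    exact intervalIntegral.norm_integral_le_of_norm_le ht
      (Filter.Eventually.of_forall fun s hs => hf s hs) (hcont.intervalIntegrable _ _)
  have hexp : Real.exp (-β * (T - t)) * Real.exp (β * (T - t)) = 1 := by
    rw [← Real.exp_add]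
    simp
  have hexp_le : Real.exp (-β * (T - t)) ≤ 1 :=
    Real.exp_le_one_iff.mpr (by nlinarith)
  have hBt : 0 ≤ B * (T - t) := mul_nonneg hB (sub_nonneg.mpr ht)
  have hAβ : 0 ≤ A / β := by positivity
  calc Real.exp (-β * (T - t)) * |∫ s in t..T, f s|
      ≤ Real.exp (-β * (T - t)) *
          (A / β * (Real.exp (β * (T - t)) - 1) + B * (T - t)) := by gcongr
    _ = A / β * (1 - Real.exp (-β * (T - t))) + Real.exp (-β * (T - t)) * (B * (T - t)) := by
        linear_combination A / β * hexp
    _ ≤ A / β * 1 + 1 * (B * (T - t)) := by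
        gcongr
        linarith [Real.exp_pos (-β * (T - t))]
    _ = A / β + B * (T - t) := by ring

/-- **Self-map estimate in the proof of Theorem 3.7.**  Let `T > 0`, `E` a
compact interval, `Z^{t,z}` the flow of `b` with derivative `∂_z Z` uniformly bounded by `L_Z`,
`h ∈ C_b¹(E)` with `|h'| ≤ L_h`, and `ĝ` with `‖ĝ(s,w)‖_∞ ≤ L‖w‖_∞ + K`.  For
`(Ĝv)(t,z) = h'(Z_T^{t,z}) ∂_z Z_T^{t,z} + ∫_t^T (∂_z Z_s^{t,z}) ĝ^{Z_s^{t,z}}(s,v_s) ds`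
one has, for every `β > 0`, `v ∈ C_b([0,T]×E)` and `(t,z) ∈ [0,T]×E`,
`e^{−β(T−t)} |(Ĝv)(t,z)| ≤ (L_Z L/β) ‖v‖_β + L_Z K T + L_Z L_h`;
in particular, for `β = 2 L_Z L`, `Ĝ` maps `N = {v : ‖v‖_β ≤ 2 L_Z (KT + L_h)}` into itself. -/
theorem stmt_10
    (T : ℝ) (hT : 0 < T)
    (E : Set ℝ) (hE_cpt : IsCompact E) (hE : E.OrdConnected)
    (b : ℝ → ℝ → ℝ)
    (hb_cont : ContinuousOn (fun p : ℝ × ℝ => b p.1 p.2) (Set.Icc 0 T ×ˢ E))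
    (Z : ℝ → ℝ → ℝ → ℝ)
    (hZ : ∀ t ∈ Set.Icc 0 T, ∀ z ∈ E, ∀ s ∈ Set.Icc t T,
      Z t z s ∈ E ∧ Z t z s = z + ∫ u in t..s, b u (Z t z u))
    (DZ : ℝ → ℝ → ℝ → ℝ)
    (hDZ : ∀ t ∈ Set.Icc 0 T, ∀ z ∈ E, ∀ s ∈ Set.Icc t T,
      HasDerivWithinAt (fun w => Z t w s) (DZ t z s) E z)
    (LZ : ℝ) (hLZ : 0 < LZ)
    (hDZ_bdd : ∀ t ∈ Set.Icc 0 T, ∀ z ∈ E, ∀ s ∈ Set.Icc t T, |DZ t z s| ≤ LZ)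
    (h h' : ℝ → ℝ)
    (hh : ∀ z ∈ E, HasDerivWithinAt h (h' z) E z)
    (Lh : ℝ) (hLh : ∀ z ∈ E, |h' z| ≤ Lh)
    (ghat : ℝ → (ℝ → ℝ) → ℝ → ℝ) (L K : ℝ) (hL : 0 < L) (hK : 0 ≤ K)
    (hghat_cont : ∀ s ∈ Set.Icc 0 T, ∀ w : ℝ → ℝ, ContinuousOn w E →
      ContinuousOn (ghat s w) E)
    (hghat_bdd : ∀ s ∈ Set.Icc 0 T, ∀ w : ℝ → ℝ, ContinuousOn w E →
      ∀ M : ℝ, (∀ y ∈ E, |w y| ≤ M) → ∀ z ∈ E, |ghat s w z| ≤ L * M + K) :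
    let Ghat : (ℝ → ℝ → ℝ) → ℝ → ℝ → ℝ := fun v t z =>
      h' (Z t z T) * DZ t z T + ∫ s in t..T, DZ t z s * ghat s (v s) (Z t z s)
    let nβ : ℝ → (ℝ → ℝ → ℝ) → ℝ := fun β v =>
      sSup ((fun p : ℝ × ℝ => Real.exp (-β * (T - p.1)) * |v p.1 p.2|) '' (Set.Icc 0 T ×ˢ E))
    (∀ β : ℝ, 0 < β → ∀ v : ℝ → ℝ → ℝ,
      ContinuousOn (fun p : ℝ × ℝ => v p.1 p.2) (Set.Icc 0 T ×ˢ E) →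
      (∃ C : ℝ, ∀ t ∈ Set.Icc 0 T, ∀ z ∈ E, |v t z| ≤ C) →
      ∀ t ∈ Set.Icc 0 T, ∀ z ∈ E,
        Real.exp (-β * (T - t)) * |Ghat v t z| ≤
          LZ * L / β * nβ β v + LZ * K * T + LZ * Lh) ∧
    (∀ v : ℝ → ℝ → ℝ,
      ContinuousOn (fun p : ℝ × ℝ => v p.1 p.2) (Set.Icc 0 T ×ˢ E) →
      (∃ C : ℝ, ∀ t ∈ Set.Icc 0 T, ∀ z ∈ E, |v t z| ≤ C) →
      nβ (2 * LZ * L) v ≤ 2 * LZ * (K * T + Lh) →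
      nβ (2 * LZ * L) (Ghat v) ≤ 2 * LZ * (K * T + Lh)) := by
  intro Ghat nβ
  have estimate : ∀ β : ℝ, 0 < β → ∀ v : ℝ → ℝ → ℝ,
      ContinuousOn (fun p : ℝ × ℝ => v p.1 p.2) (Set.Icc 0 T ×ˢ E) →
      (∃ C : ℝ, ∀ t ∈ Set.Icc 0 T, ∀ z ∈ E, |v t z| ≤ C) →
      ∀ t ∈ Set.Icc 0 T, ∀ z ∈ E,
        Real.exp (-β * (T - t)) * |Ghat v t z| ≤
          LZ * L / β * nβ β v + LZ * K * T + LZ * Lh := by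
    rintro β hβ v hv ⟨C, hC⟩ t ht z hz
    have hexp_le : ∀ s ∈ Set.Icc 0 T, Real.exp (-β * (T - s)) ≤ 1 := fun s hs =>
      Real.exp_le_one_iff.mpr (by nlinarith [hs.2])
    have hbdd : BddAbove ((fun p : ℝ × ℝ => Real.exp (-β * (T - p.1)) * |v p.1 p.2|) ''
        (Set.Icc 0 T ×ˢ E)) := by
      refine ⟨C, ?_⟩
      rintro _ ⟨⟨s, y⟩, ⟨hs, hy⟩, rfl⟩
      exact (mul_le_of_le_one_left (abs_nonneg _) (hexp_le s hs)).trans (hC s hs y hy)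
    have hnorm : ∀ s ∈ Set.Icc 0 T, ∀ y ∈ E,
        Real.exp (-β * (T - s)) * |v s y| ≤ nβ β v := fun s hs y hy =>
      le_csSup hbdd ⟨(s, y), ⟨hs, hy⟩, rfl⟩
    have hn : 0 ≤ nβ β v := le_trans (by positivity) (hnorm t ht z hz)
    have hv_le : ∀ s ∈ Set.Icc 0 T, ∀ y ∈ E, |v s y| ≤ Real.exp (β * (T - s)) * nβ β v := by
      intro s hs y hy
      have hmul := mul_le_mul_of_nonneg_left (hnorm s hs y hy) (Real.exp_pos (β * (T - s))).le
      rwa [← mul_assoc, ← Real.exp_add, neg_mul, add_neg_cancel, Real.exp_zero, one_mul] at hmul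
    have hintegrand : ∀ s ∈ Set.Ioc t T, |DZ t z s * ghat s (v s) (Z t z s)| ≤
        LZ * L * nβ β v * Real.exp (β * (T - s)) + LZ * K := by
      intro s hs
      have hs' : s ∈ Set.Icc t T := ⟨hs.1.le, hs.2⟩
      have hs₀ : s ∈ Set.Icc 0 T := ⟨ht.1.trans hs.1.le, hs.2⟩
      have hvs : ContinuousOn (v s) E :=
        hv.comp (f := fun y => (s, y)) (by fun_prop) fun y hy => ⟨hs₀, hy⟩
      have hg := hghat_bdd s hs₀ (v s) hvs _ (hv_le s hs₀) _ (hZ t ht z hz s hs').1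
      rw [abs_mul]
      calc |DZ t z s| * |ghat s (v s) (Z t z s)|
          ≤ LZ * (L * (Real.exp (β * (T - s)) * nβ β v) + K) :=
            mul_le_mul (hDZ_bdd t ht z hz s hs') hg (abs_nonneg _) hLZ.le
        _ = LZ * L * nβ β v * Real.exp (β * (T - s)) + LZ * K := by ring
    have hint := exp_mul_abs_integral_le (by positivity) (by positivity) hβ ht.2 hintegrand
    have hT_mem : T ∈ Set.Icc t T := ⟨ht.2, le_rfl⟩
    have hterm : |h' (Z t z T) * DZ t z T| ≤ Lh * LZ := by
      have hh' := hLh _ (hZ t ht z hz T hT_mem).1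
      rw [abs_mul]
      exact mul_le_mul hh' (hDZ_bdd t ht z hz T hT_mem) (abs_nonneg _) ((abs_nonneg _).trans hh')
    have hterm' : Real.exp (-β * (T - t)) * |h' (Z t z T) * DZ t z T| ≤ Lh * LZ :=
      (mul_le_of_le_one_left (abs_nonneg _) (hexp_le t ht)).trans hterm
    have htime : LZ * K * (T - t) ≤ LZ * K * T :=
      mul_le_mul_of_nonneg_left (by linarith [ht.1]) (by positivity)
    calc Real.exp (-β * (T - t)) * |Ghat v t z|
        ≤ Real.exp (-β * (T - t)) * (|h' (Z t z T) * DZ t z T| +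
            |∫ s in t..T, DZ t z s * ghat s (v s) (Z t z s)|) := by
          gcongr
          exact abs_add_le _ _
      _ ≤ Lh * LZ + (LZ * L * nβ β v / β + LZ * K * (T - t)) := by
          rw [mul_add]
          exact add_le_add hterm' hint
      _ ≤ Lh * LZ + (LZ * L * nβ β v / β + LZ * K * T) := by gcongr
      _ = LZ * L / β * nβ β v + LZ * K * T + LZ * Lh := by ring
  refine ⟨estimate, fun v hv hv_bdd hvN => ?_⟩
  rcases E.eq_empty_or_nonempty with rfl | ⟨z, hz⟩
  · simpa [nβ] using hvN
  · refine csSup_le (Set.Nonempty.image _ ⟨(0, z), ⟨le_rfl, hT.le⟩, hz⟩) ?_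
    rintro _ ⟨⟨t, y⟩, ⟨ht, hy⟩, rfl⟩
    have hest := estimate (2 * LZ * L) (by positivity) v hv hv_bdd t ht y hy
    have hhalf : LZ * L / (2 * LZ * L) = 1 / 2 := by field_simp
    rw [hhalf] at hest
    refine hest.trans ?_
    linarith
end
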